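/- As n → ∞, the number h_n' of simple normalized set systems of weight n satisfies h_n' = ((log 2)^{-1} + o(1))^n · b_n; equivalently, lim_{n→∞} (h_n' / b_n)^{1/n} = 1/log 2. -/

import Mathlib

open Filter

/-- The weight of a set system: the sum of edge sizes, counted with multiplicity. -/
def sysWeight (H : Multiset (Finset ℕ)) : ℕ := (H.map Finset.card).sum

/-- A set system is normalized if all its edges are nonempty and its vertex set
(the union of its edges) equals `{1, …, m}` for some `m`. -/
def IsNormalized (H : Multiset (Finset ℕ)) : Prop :=
  (∀ E ∈ H, E.Nonempty) ∧ ∃ m : ℕ, H.sup = Finset.Icc 1 m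

/-- `hpp n` = `hₙ''`, the number of normalized set systems (multisets of edges allowed)
of weight `n`. -/
noncomputable def hpp (n : ℕ) : ℕ :=
  Nat.card {H : Multiset (Finset ℕ) // IsNormalized H ∧ sysWeight H = n}

/-- `hp n` = `hₙ'`, the number of simple (no repeated edges) normalized set systems
of weight `n`. -/
noncomputable def hp (n : ℕ) : ℕ :=
  Nat.card {H : Multiset (Finset ℕ) // IsNormalized H ∧ sysWeight H = n ∧ H.Nodup}

/-- The `n`-th Bell number: the number of partitions (equivalence relations)
of an `n`-element set. -/
noncomputable def bell (n : ℕ) : ℕ := Nat.card (Setoid (Fin n))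

/-- The number of sequences of nonempty subsets of a `k`-element set with total size `N`. -/
def seqCount (k : ℕ) : ℕ → ℕ
  | 0 => 1
  | N + 1 => ∑ c : Fin (N + 1), k.choose (c + 1) * seqCount k (N - c)

theorem seqCount_succ (k N : ℕ) :
    seqCount k (N + 1) = ∑ c ∈ Finset.range (N + 1), k.choose (c + 1) * seqCount k (N - c) := by
  rw [seqCount, Finset.sum_range]

/-- The sequences counted by `seqCount`. -/
def subsetSeqs (k N : ℕ) : Set (List (Finset (Fin k))) :=
  {l | (∀ s ∈ l, s.Nonempty) ∧ (l.map Finset.card).sum = N}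

theorem exists_finset_subsetSeqs (k N : ℕ) :
    ∃ S : Finset (List (Finset (Fin k))), (S : Set _) = subsetSeqs k N ∧
      S.card = seqCount k N := by
  induction N using Nat.strong_induction_on with
  | _ N ih =>
  rcases N with _ | N
  · refine ⟨{[]}, ?_, by simp [seqCount]⟩
    ext l
    rcases l with _ | ⟨s, l⟩
    · simp [subsetSeqs]
    · simp only [Finset.coe_singleton, Set.mem_singleton_iff, subsetSeqs, Set.mem_ofPred_eq]
      constructor
      · simp
      · rintro ⟨h, h'⟩
        have := (h s (by simp)).card_pos
        simp only [List.map_cons, List.sum_cons] at h'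
        omega
  · have ih' : ∀ c : Fin (N + 1), ∃ S : Finset (List (Finset (Fin k))),
        (S : Set _) = subsetSeqs k (N - c) ∧ S.card = seqCount k (N - c) :=
      fun c => ih _ (by omega)
    choose S hS hcard using ih'
    let T : Fin (N + 1) → Finset (List (Finset (Fin k))) := fun c =>
      (Finset.powersetCard (c + 1) Finset.univ ×ˢ S c).image (fun p => p.1 :: p.2)
    refine ⟨Finset.univ.biUnion T, ?_, ?_⟩
    · ext l
      simp only [Finset.coe_biUnion, Finset.mem_coe, Finset.mem_univ, Set.iUnion_true,
        Set.mem_iUnion, T, Finset.mem_image, Finset.mem_product, Finset.mem_powersetCard,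
        Finset.subset_univ, true_and, Prod.exists]
      constructor
      · rintro ⟨c, s, l', ⟨hs, hl'⟩, rfl⟩
        rw [← Finset.mem_coe, hS] at hl'
        refine ⟨?_, ?_⟩
        · intro t ht
          rcases List.mem_cons.1 ht with rfl | ht
          · exact Finset.card_pos.1 (by omega)
          · exact hl'.1 t ht
        · have := hl'.2
          simp only [List.map_cons, List.sum_cons]
          omega
      · rintro ⟨h, h'⟩
        rcases l with _ | ⟨s, l⟩
        · simp at h'
        · have hs := (h s (by simp)).card_pos
          simp only [List.map_cons, List.sum_cons] at h'
          refine ⟨⟨s.card - 1, by omega⟩, s, l, ⟨by simp; omega, ?_⟩, rfl⟩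
          rw [← Finset.mem_coe, hS]
          refine ⟨fun t ht => h t (by simp [ht]), ?_⟩
          simp only
          omega
    · rw [Finset.card_biUnion, seqCount]
      · refine Finset.sum_congr rfl fun c _ => ?_
        rw [Finset.card_image_of_injective, Finset.card_product, Finset.card_powersetCard, hcard]
        · simp
        · rintro ⟨a, b⟩ ⟨a', b'⟩ h
          simpa using h
      · intro c _ c' _ hcc
        rw [Function.onFun, Finset.disjoint_left]
        intro l hl hl'
        simp only [T, Finset.mem_image, Finset.mem_product, Finset.mem_powersetCard,
          Finset.subset_univ, true_and, Prod.exists] at hl hl'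
        obtain ⟨s, l1, ⟨hs, -⟩, rfl⟩ := hl
        obtain ⟨s', l1', ⟨hs', -⟩, h⟩ := hl'
        simp only [List.cons.injEq] at h
        apply hcc
        rw [← h.1] at hs
        exact Fin.ext (by omega)

instance finite_subsetSeqs (k N : ℕ) : Finite (subsetSeqs k N) := by
  obtain ⟨S, hS, -⟩ := exists_finset_subsetSeqs k N
  rw [← hS]
  infer_instance

theorem card_subsetSeqs (k N : ℕ) : Nat.card (subsetSeqs k N) = seqCount k N := by
  obtain ⟨S, hS, hc⟩ := exists_finset_subsetSeqs k N
  rw [← hS, ← hc]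
  simp

theorem seqCount_le (k N : ℕ) : (seqCount k N : ℝ) ≤ (k / Real.log 2) ^ N := by
  have hρ : 0 < Real.log 2 := Real.log_pos (by norm_num)
  induction N using Nat.strong_induction_on with
  | _ N ih =>
  rcases N with _ | N
  · simp [seqCount]
  · rw [seqCount_succ]
    push_cast
    have hexp : ∑ c ∈ Finset.range (N + 1), Real.log 2 ^ (c + 1) / (c + 1).factorial ≤ 1 := by
      have h := Real.sum_le_exp_of_nonneg hρ.le (N + 2)
      rw [Finset.sum_range_succ', Real.exp_log (by norm_num)] at h
      norm_num at h ⊢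
      linarith
    calc ∑ c ∈ Finset.range (N + 1), (k.choose (c + 1) : ℝ) * seqCount k (N - c)
        ≤ ∑ c ∈ Finset.range (N + 1), (k : ℝ) ^ (c + 1) / (c + 1).factorial *
            (k / Real.log 2) ^ (N - c) := by
          refine Finset.sum_le_sum fun c _ => ?_
          gcongr
          · exact Nat.choose_le_pow_div _ _
          · exact ih _ (by omega)
      _ = (k / Real.log 2) ^ (N + 1) *
            ∑ c ∈ Finset.range (N + 1), Real.log 2 ^ (c + 1) / (c + 1).factorial := by
          rw [Finset.mul_sum]
          refine Finset.sum_congr rfl fun c hc => ?_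
          have : N + 1 = (N - c) + (c + 1) := by have := Finset.mem_range.1 hc; omega
          rw [this, pow_add (k / Real.log 2 : ℝ), div_pow _ _ (c + 1)]
          have : Real.log 2 ^ (c + 1) ≠ 0 := by positivity
          have : N - c + (c + 1) - (c + 1) = N - c := by omega
          field_simp
      _ ≤ (k / Real.log 2) ^ (N + 1) * 1 := by gcongr
      _ = _ := mul_one _

theorem pow_le_seqCount (k N : ℕ) : k ^ N ≤ seqCount k N := by
  induction N with
  | zero => simp [seqCount]
  | succ N ih =>
    rw [seqCount_succ, Finset.sum_range_succ']
    simp only [zero_add, Nat.choose_one_right, Nat.sub_zero]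
    calc k ^ (N + 1) = k * k ^ N := by ring
      _ ≤ k * seqCount k N := by gcongr
      _ ≤ _ := Nat.le_add_left _ _

theorem le_seqCount {K k : ℕ} (hk : K ≤ k) {r : ℝ} (hr : 0 < r) (hr1 : r ≤ 1)
    (hK : 1 ≤ ∑ c ∈ Finset.range K, r ^ (c + 1) / (c + 1).factorial) (N : ℕ) :
    r ^ K * (((k - K : ℕ) : ℝ) / r) ^ N ≤ seqCount k N := by
  induction N using Nat.strong_induction_on with
  | _ N ih =>
  rcases le_or_gt N K with hN | hN
  · calc r ^ K * (((k - K : ℕ) : ℝ) / r) ^ N = r ^ (K - N) * ((k - K : ℕ) : ℝ) ^ N := by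
          obtain ⟨d, rfl⟩ := Nat.exists_eq_add_of_le hN
          rw [Nat.add_sub_cancel_left, pow_add, div_pow]
          field_simp
      _ ≤ 1 * (k : ℝ) ^ N := by
          gcongr
          · exact pow_le_one₀ hr.le hr1
          · omega
      _ ≤ _ := by
          rw [one_mul]
          exact_mod_cast pow_le_seqCount k N
  · obtain ⟨N, rfl⟩ : ∃ N', N = N' + 1 := ⟨N - 1, by omega⟩
    rw [seqCount_succ]
    push_cast
    set x : ℝ := ((k - K : ℕ) : ℝ) with hx
    have hx0 : 0 ≤ x := Nat.cast_nonneg _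
    calc r ^ K * (x / r) ^ (N + 1)
        ≤ r ^ K * (x / r) ^ (N + 1) *
            ∑ c ∈ Finset.range K, r ^ (c + 1) / (c + 1).factorial :=
          le_mul_of_one_le_right (by positivity) hK
      _ = ∑ c ∈ Finset.range K, x ^ (c + 1) / (c + 1).factorial *
            (r ^ K * (x / r) ^ (N - c)) := by
          rw [Finset.mul_sum]
          refine Finset.sum_congr rfl fun c hc => ?_
          have : N + 1 = (N - c) + (c + 1) := by have := Finset.mem_range.1 hc; omega
          rw [this, pow_add (x / r), div_pow _ _ (c + 1)]
          have : N - c + (c + 1) - (c + 1) = N - c := by omega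
          field_simp
      _ ≤ ∑ c ∈ Finset.range K, (k.choose (c + 1) : ℝ) * seqCount k (N - c) := by
          refine Finset.sum_le_sum fun c hc => ?_
          have hc := Finset.mem_range.1 hc
          gcongr
          · rw [div_le_iff₀ (by positivity), mul_comm]
            have h1 := Nat.pow_sub_le_descFactorial k (c + 1)
            rw [Nat.descFactorial_eq_factorial_mul_choose] at h1
            have h2 : (k - K) ^ (c + 1) ≤ (k + 1 - (c + 1)) ^ (c + 1) :=
              Nat.pow_le_pow_left (by omega) _
            rw [hx]
            exact_mod_cast h2.trans h1
          · exact ih _ (by omega)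
      _ ≤ _ := by
          refine Finset.sum_le_sum_of_subset_of_nonneg ?_ fun _ _ _ => by positivity
          exact Finset.range_subset_range.2 (by omega)

instance finite_setoid_fin (n : ℕ) : Finite (Setoid (Fin n)) :=
  Finite.of_injective (fun s : Setoid (Fin n) => s.r) fun s t h => Setoid.ext fun a b => by
    exact iff_of_eq (congrFun (congrFun h a) b)

theorem pow_le_factorial_mul_bell (n k : ℕ) : k ^ n ≤ k.factorial * bell n := by
  classical
  have := Fintype.ofFinite (Setoid (Fin n))
  let F : (Fin n → Fin k) → Σ s : Setoid (Fin n), (Quotient s ↪ Fin k) := fun f =>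
    ⟨Setoid.ker f, ⟨Quotient.lift f fun _ _ h => h, by
      rintro ⟨a⟩ ⟨b⟩ h
      exact Quotient.sound h⟩⟩
  have hF : Function.Injective F := by
    intro f g h
    have key : ∀ f : Fin n → Fin k, f = fun i => (F f).2 (Quotient.mk _ i) := fun f => rfl
    rw [key f, key g, h]
  have hle := Nat.card_le_card_of_injective F hF
  rw [Nat.card_sigma] at hle
  calc k ^ n = Nat.card (Fin n → Fin k) := by simp
    _ ≤ _ := hle
    _ ≤ ∑ _s : Setoid (Fin n), k.factorial := by
        refine Finset.sum_le_sum fun s _ => ?_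
        rw [Nat.card_eq_fintype_card, Fintype.card_embedding_eq, Fintype.card_fin]
        rcases le_or_gt (Fintype.card (Quotient s)) k with h | h
        · rw [← Nat.factorial_mul_descFactorial h]
          exact Nat.le_mul_of_pos_left _ (Nat.factorial_pos _)
        · rw [Nat.descFactorial_of_lt h]
          exact Nat.zero_le _
    _ = k.factorial * bell n := by
        rw [Finset.sum_const, smul_eq_mul, mul_comm, bell, Nat.card_eq_fintype_card,
          Finset.card_univ]

theorem card_eq_sum_card_fiber {α : Type*} [Finite α] (f : α → ℕ) (n : ℕ) (hf : ∀ a, f a ≤ n) :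
    Nat.card α = ∑ j ∈ Finset.range (n + 1), Nat.card {a // f a = j} := by
  classical
  have := Fintype.ofFinite α
  rw [Nat.card_eq_fintype_card, ← Finset.card_univ,
    Finset.card_eq_sum_card_fiberwise (f := f) (t := Finset.range (n + 1))
      (fun a _ => by simpa [Nat.lt_succ_iff] using hf a)]
  refine Finset.sum_congr rfl fun j _ => ?_
  rw [Nat.card_eq_fintype_card, Fintype.card_subtype]

theorem factorial_mul_card_setoid_le (n j : ℕ) :
    j.factorial * Nat.card {s : Setoid (Fin n) // Nat.card (Quotient s) = j} ≤ j ^ n := by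
  classical
  let e : ∀ s : {s : Setoid (Fin n) // Nat.card (Quotient s) = j}, Quotient s.1 ≃ Fin j :=
    fun s => Finite.equivFinOfCardEq s.2
  let F : Equiv.Perm (Fin j) × {s : Setoid (Fin n) // Nat.card (Quotient s) = j} →
      (Fin n → Fin j) := fun p i => p.1 (e p.2 (Quotient.mk _ i))
  have hF : Function.Injective F := by
    rintro ⟨σ, s⟩ ⟨τ, t⟩ h
    have hker : ∀ σ s, Setoid.ker (F (σ, s)) = s.1 := by
      intro σ s
      ext a b
      rw [Setoid.ker_def]
      simp only [F, EmbeddingLike.apply_eq_iff_eq]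
      exact Quotient.eq
    obtain rfl : s = t := Subtype.ext (by rw [← hker σ s, ← hker τ t, h])
    congr 1
    ext x
    obtain ⟨q, rfl⟩ := (e s).surjective x
    obtain ⟨a, rfl⟩ := Quotient.exists_rep q
    exact congrArg Fin.val (congrFun h a)
  have hle := Nat.card_le_card_of_injective F hF
  rw [Nat.card_prod, Nat.card_perm, Nat.card_fin] at hle
  simpa using hle

theorem bell_le_sum (n : ℕ) :
    (bell n : ℝ) ≤ ∑ j ∈ Finset.range (n + 1), (j : ℝ) ^ n / j.factorial := by
  rw [bell, card_eq_sum_card_fiber (fun s : Setoid (Fin n) => Nat.card (Quotient s)) n]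
  · push_cast
    refine Finset.sum_le_sum fun j _ => ?_
    rw [le_div_iff₀ (by positivity), mul_comm]
    exact_mod_cast factorial_mul_card_setoid_le n j
  · intro s
    simpa using Nat.card_le_card_of_surjective (Quotient.mk s) Quotient.mk_surjective

theorem bell_pos (n : ℕ) : 0 < bell n := by
  have := pow_le_factorial_mul_bell n 1
  simp only [one_pow, Nat.factorial_one, one_mul] at this
  omega

theorem pow_div_factorial_le {n j : ℕ} (hj : j ≠ 0) {x : ℝ} (hx : 0 ≤ x)
    (hn : x * Real.exp x = n) :
    (j : ℝ) ^ n / j.factorial ≤ Real.exp (Real.exp x + n * x - n) := by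
  have hj0 : (0 : ℝ) < j := by positivity
  set u := Real.log j - x with hu
  have hj' : (j : ℝ) = Real.exp x * Real.exp u := by
    rw [← Real.exp_add, hu, add_sub_cancel, Real.exp_log hj0]
  have hmain : n * Real.log j ≤ j * Real.log j - j + (Real.exp x + n * x - n) := by
    have hlog : Real.log j = x + u := by rw [hu]; ring
    have h1 := Real.add_one_le_exp u
    have h2 := Real.add_one_le_exp (-u)
    have h3 : (1 - u) * Real.exp u ≤ 1 := by
      calc (1 - u) * Real.exp u ≤ Real.exp (-u) * Real.exp u := by gcongr; linarith
        _ = 1 := by rw [← Real.exp_add]; simp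
    have h4 : 0 ≤ Real.exp x * (x * (Real.exp u - 1 - u) + (1 - (1 - u) * Real.exp u)) :=
      mul_nonneg (Real.exp_pos _).le
        (add_nonneg (mul_nonneg hx (by linarith)) (by linarith))
    rw [hlog, hj', ← hn]
    nlinarith [h4]
  have hfac : Real.exp (j * Real.log j - j) ≤ j.factorial := by
    have h := Real.pow_div_factorial_le_exp j hj0.le j
    rw [div_le_iff₀ (by positivity)] at h
    rw [Real.exp_sub, div_le_iff₀ (Real.exp_pos _), mul_comm (j : ℝ) (Real.log j),
      ← Real.rpow_def_of_pos hj0, Real.rpow_natCast]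
    linarith
  rw [div_le_iff₀ (by positivity)]
  calc (j : ℝ) ^ n = Real.exp (n * Real.log j) := by
        rw [mul_comm, ← Real.rpow_def_of_pos hj0, Real.rpow_natCast]
    _ ≤ Real.exp (j * Real.log j - j + (Real.exp x + n * x - n)) := Real.exp_le_exp.2 hmain
    _ = Real.exp (Real.exp x + n * x - n) * Real.exp (j * Real.log j - j) := by
        rw [Real.exp_add, mul_comm]
    _ ≤ _ := by gcongr

theorem bell_le {n : ℕ} (hn0 : n ≠ 0) {x : ℝ} (hx : 0 ≤ x) (hn : x * Real.exp x = n) :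
    (bell n : ℝ) ≤ (n + 1) * Real.exp (Real.exp x + n * x - n) := by
  refine (bell_le_sum n).trans ?_
  calc _ ≤ ∑ _j ∈ Finset.range (n + 1), Real.exp (Real.exp x + n * x - n) := by
        refine Finset.sum_le_sum fun j _ => ?_
        rcases eq_or_ne j 0 with rfl | hj
        · simp only [Nat.cast_zero, zero_pow hn0, zero_div]
          positivity
        · exact pow_div_factorial_le hj hx hn
    _ = _ := by simp

theorem sum_card_filter_mem {k : ℕ} (m : ℕ) (A : ℕ → Finset (Fin k)) :
    ∑ i, ((Finset.range m).filter fun j => i ∈ A j).card = ∑ j ∈ Finset.range m, (A j).card := by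
  simp_rw [Finset.card_filter]
  rw [Finset.sum_comm]
  refine Finset.sum_congr rfl fun j _ => ?_
  simp

theorem sum_map_eq_sum_getD {α : Type*} (l : List α) (f : α → ℕ) (d : α) :
    (l.map f).sum = ∑ j ∈ Finset.range l.length, f (l.getD j d) := by
  induction l with
  | nil => simp
  | cons a l ih =>
    rw [List.length_cons, Finset.sum_range_succ', List.map_cons, List.sum_cons, ih, add_comm]
    simp

/-- The `i`-th edge of the set system with `k` edges in which vertex `i + 1` is private to the
`i`-th edge, and vertex `k + 1 + j` lies in the edges listed by the `j`-th entry of `l`. -/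
def taggedEdge {k : ℕ} (l : List (Finset (Fin k))) (i : Fin k) : Finset ℕ :=
  insert (i.val + 1)
    (((Finset.range l.length).filter fun j => i ∈ l.getD j ∅).image fun j => k + 1 + j)

theorem mem_taggedEdge {k : ℕ} {l : List (Finset (Fin k))} {i : Fin k} {v : ℕ} :
    v ∈ taggedEdge l i ↔ v = i.val + 1 ∨ ∃ j < l.length, i ∈ l.getD j ∅ ∧ k + 1 + j = v := by
  simp [taggedEdge, and_assoc]

theorem succ_mem_taggedEdge {k : ℕ} {l : List (Finset (Fin k))} {i i' : Fin k} :
    i.val + 1 ∈ taggedEdge l i' ↔ i = i' := by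
  rw [mem_taggedEdge, Fin.ext_iff]
  constructor
  · rintro (h | ⟨j, -, -, h⟩) <;> omega
  · intro h
    omega

theorem taggedEdge_injective {k : ℕ} (l : List (Finset (Fin k))) :
    Function.Injective (taggedEdge l) := by
  intro i i' h
  rw [← succ_mem_taggedEdge (l := l), ← h, succ_mem_taggedEdge]

theorem sup_taggedEdge {k : ℕ} {l : List (Finset (Fin k))} (hl : ∀ s ∈ l, s.Nonempty) :
    Finset.univ.sup (taggedEdge l) = Finset.Icc 1 (k + l.length) := by
  ext v
  simp only [Finset.mem_sup, Finset.mem_univ, true_and, Finset.mem_Icc, mem_taggedEdge]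
  constructor
  · rintro ⟨i, h | ⟨j, hj, -, h⟩⟩ <;> omega
  · rintro ⟨h1, h2⟩
    rcases le_or_gt v k with hv | hv
    · exact ⟨⟨v - 1, by omega⟩, Or.inl (by simp only; omega)⟩
    · have hj : v - (k + 1) < l.length := by omega
      obtain ⟨i, hi⟩ := hl _ (List.getElem_mem hj)
      refine ⟨i, Or.inr ⟨v - (k + 1), hj, ?_, by omega⟩⟩
      rwa [List.getD_eq_getElem _ _ hj]

theorem sum_card_taggedEdge {k : ℕ} (l : List (Finset (Fin k))) :
    ∑ i, (taggedEdge l i).card = (l.map Finset.card).sum + k := by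
  have h : ∀ i, (taggedEdge l i).card =
      ((Finset.range l.length).filter fun j => i ∈ l.getD j ∅).card + 1 := by
    intro i
    rw [taggedEdge, Finset.card_insert_of_notMem, Finset.card_image_of_injective]
    · intro a b h
      simpa using h
    · simp only [Finset.mem_image, not_exists, not_and]
      intro j _ h
      omega
  simp_rw [h]
  rw [Finset.sum_add_distrib, sum_card_filter_mem, sum_map_eq_sum_getD _ _ ∅]
  simp

theorem eq_of_taggedEdge_eq {k : ℕ} {l l' : List (Finset (Fin k))} (hl : ∀ s ∈ l, s.Nonempty)
    (hl' : ∀ s ∈ l', s.Nonempty) (h : taggedEdge l = taggedEdge l') : l = l' := by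
  have hlen : l.length = l'.length := by
    have h1 := sup_taggedEdge hl
    rw [h, sup_taggedEdge hl'] at h1
    have h2 := congrArg Finset.card h1
    simp only [Nat.card_Icc] at h2
    omega
  have key : ∀ (l : List (Finset (Fin k))) (j : ℕ) (hj : j < l.length) (i : Fin k),
      i ∈ l[j] ↔ k + 1 + j ∈ taggedEdge l i := by
    intro l j hj i
    rw [mem_taggedEdge, ← List.getD_eq_getElem _ ∅ hj]
    constructor
    · exact fun hi => Or.inr ⟨j, hj, hi, rfl⟩
    · rintro (h | ⟨j', -, hi, h⟩)
      · omega
      · obtain rfl : j' = j := by omega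
        exact hi
  refine List.ext_getElem hlen fun j h1 h2 => ?_
  ext i
  rw [key l j h1, key l' j h2, h]

/-- The simple normalized set systems of weight `n`. -/
abbrev SimpleSystem (n : ℕ) : Type :=
  {H : Multiset (Finset ℕ) // IsNormalized H ∧ sysWeight H = n ∧ H.Nodup}

theorem card_sup_le_sysWeight (H : Multiset (Finset ℕ)) : H.sup.card ≤ sysWeight H := by
  induction H using Multiset.induction_on with
  | empty => simp [sysWeight]
  | cons E H ih =>
    simp only [sysWeight, Multiset.sup_cons, Multiset.map_cons, Multiset.sum_cons] at ih ⊢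
    exact (Finset.card_union_le _ _).trans (by gcongr)

theorem card_le_sysWeight {H : Multiset (Finset ℕ)} (hH : ∀ E ∈ H, E.Nonempty) :
    H.card ≤ sysWeight H := by
  induction H using Multiset.induction_on with
  | empty => simp
  | cons E H ih =>
    have h1 := (hH E (by simp)).card_pos
    have h2 := ih fun E' h => hH E' (by simp [h])
    simp only [sysWeight, Multiset.map_cons, Multiset.sum_cons, Multiset.card_cons] at h2 ⊢
    omega

instance finite_simpleSystem (n : ℕ) : Finite (SimpleSystem n) := by
  refine Finite.of_injective (β := ((Finset.Icc 1 n).powerset.powerset : Finset _))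
    (fun H => ⟨⟨H.1, H.2.2.2⟩, ?_⟩) ?_
  · obtain ⟨H, ⟨-, m, hm⟩, hw, hH⟩ := H
    rw [Finset.mem_powerset]
    intro E hE
    rw [Finset.mem_powerset]
    have h1 : E ≤ H.sup := Multiset.le_sup hE
    have h2 := card_sup_le_sysWeight H
    rw [hm, Nat.card_Icc, hw] at h2
    rw [hm] at h1
    exact h1.trans (Finset.Icc_subset_Icc_right (by omega))
  · intro H H' h
    simpa [Subtype.ext_iff] using h

theorem seqCount_le_hp {n k : ℕ} (hk : k ≤ n) : seqCount k (n - k) ≤ hp n := by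
  rw [← card_subsetSeqs, hp]
  let F : subsetSeqs k (n - k) → SimpleSystem n := fun l =>
    ⟨Finset.univ.val.map (taggedEdge l.1), by
      obtain ⟨l, hl, hw⟩ := l
      refine ⟨⟨?_, k + l.length, sup_taggedEdge hl⟩, ?_, ?_⟩
      · intro E hE
        obtain ⟨i, -, rfl⟩ := Multiset.mem_map.1 hE
        exact ⟨_, succ_mem_taggedEdge.2 rfl⟩
      · rw [sysWeight, Multiset.map_map]
        refine (sum_card_taggedEdge l).trans ?_
        omega
      · exact Finset.univ.nodup.map (taggedEdge_injective l)⟩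
  refine Nat.card_le_card_of_injective F ?_
  rintro ⟨l, hl, hw⟩ ⟨l', hl', hw'⟩ h
  refine Subtype.ext (eq_of_taggedEdge_eq hl hl' (funext fun i => ?_))
  have h : Finset.univ.val.map (taggedEdge l) = Finset.univ.val.map (taggedEdge l') :=
    congrArg Subtype.val h
  have hi : taggedEdge l i ∈ Finset.univ.val.map (taggedEdge l') := by
    rw [← h]
    exact Multiset.mem_map_of_mem _ (Finset.mem_univ i)
  obtain ⟨i', -, hi'⟩ := Multiset.mem_map.1 hi
  have := succ_mem_taggedEdge (l := l) (i := i) (i' := i)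
  rw [← hi', succ_mem_taggedEdge] at this
  rw [← hi', this.2 rfl]

/-- The incidence lists of the vertices of a family of edges. -/
def incidenceSeq {k : ℕ} (E : Fin k → Finset ℕ) : List (Finset (Fin k)) :=
  (List.range (Finset.univ.sup E).card).map fun j => Finset.univ.filter fun i => j + 1 ∈ E i

theorem incidenceSeq_mem {n k m : ℕ} {E : Fin k → Finset ℕ}
    (hm : Finset.univ.sup E = Finset.Icc 1 m) (hn : ∑ i, (E i).card = n) :
    incidenceSeq E ∈ subsetSeqs k n := by
  rw [incidenceSeq, hm, Nat.card_Icc, Nat.add_sub_cancel]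
  constructor
  · intro s hs
    obtain ⟨j, hj, rfl⟩ := List.mem_map.1 hs
    have hj : j + 1 ∈ Finset.univ.sup E := by
      rw [hm, Finset.mem_Icc]
      have := List.mem_range.1 hj
      omega
    obtain ⟨i, -, hi⟩ := Finset.mem_sup.1 hj
    exact ⟨i, by simpa using hi⟩
  · have hE : ∀ i, (E i).card = ((Finset.range m).filter fun j =>
        i ∈ Finset.univ.filter fun i => j + 1 ∈ E i).card := by
      intro i
      refine Eq.trans ?_ (Finset.card_image_of_injective _ (add_left_injective 1))
      congr 1
      ext v
      simp only [Finset.mem_filter, Finset.mem_univ, true_and, Finset.mem_image,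
        Finset.mem_range]
      constructor
      · intro hv
        have : v ∈ Finset.univ.sup E := Finset.mem_sup.2 ⟨i, Finset.mem_univ i, hv⟩
        rw [hm, Finset.mem_Icc] at this
        have h1 : v - 1 + 1 = v := by omega
        exact ⟨v - 1, ⟨by omega, by rwa [h1]⟩, h1⟩
      · rintro ⟨j, ⟨-, hj⟩, rfl⟩
        exact hj
    rw [← hn]
    simp_rw [hE]
    rw [sum_card_filter_mem, List.map_map]
    rfl

theorem eq_of_incidenceSeq_eq {k m m' : ℕ} {E E' : Fin k → Finset ℕ}
    (hm : Finset.univ.sup E = Finset.Icc 1 m) (hm' : Finset.univ.sup E' = Finset.Icc 1 m')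
    (h : incidenceSeq E = incidenceSeq E') : E = E' := by
  have hlen := congrArg List.length h
  simp only [incidenceSeq, hm, hm', Nat.card_Icc, Nat.add_sub_cancel, List.length_map,
    List.length_range] at hlen h
  subst hlen
  rw [List.map_inj_left] at h
  funext i
  ext v
  by_cases hv : v ∈ Finset.Icc 1 m
  · rw [Finset.mem_Icc] at hv
    have h1 := congrArg (i ∈ ·) (h (v - 1) (List.mem_range.2 (by omega)))
    have h2 : v - 1 + 1 = v := by omega
    simpa [h2] using h1
  · have aux : ∀ E : Fin k → Finset ℕ, Finset.univ.sup E = Finset.Icc 1 m → v ∉ E i :=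
      fun E hE hi => hv (hE ▸ Finset.mem_sup.2 ⟨i, Finset.mem_univ i, hi⟩)
    exact iff_of_false (aux E hm) (aux E' hm')

theorem exists_injective_map_univ {α : Type*} {H : Multiset α} (hH : H.Nodup) {k : ℕ}
    (hk : H.card = k) :
    ∃ e : Fin k → α, Function.Injective e ∧ Finset.univ.val.map e = H := by
  subst hk
  induction H using Quotient.inductionOn with
  | _ l =>
  refine ⟨l.get, List.nodup_iff_injective_get.1 hH, ?_⟩
  change Multiset.map l.get (Finset.univ : Finset (Fin l.length)).val = (l : Multiset α)
  rw [Fin.univ_val_map, List.ofFn_get]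

theorem factorial_mul_card_simpleSystem_le (n k : ℕ) :
    k.factorial * Nat.card {H : SimpleSystem n // H.1.card = k} ≤ seqCount k n := by
  rw [← card_subsetSeqs]
  have hex : ∀ H : {H : SimpleSystem n // H.1.card = k}, ∃ e : Fin k → Finset ℕ,
      Function.Injective e ∧ Finset.univ.val.map e = H.1.1 :=
    fun H => exists_injective_map_univ H.1.2.2.2 H.2
  choose e hinj he using hex
  have hmap : ∀ (σ : Equiv.Perm (Fin k)) H, Finset.univ.val.map (e H ∘ σ) = H.1.1 := by
    intro σ H
    rw [← Multiset.map_map, Multiset.map_univ_val_equiv, he]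
  have hsup : ∀ (σ : Equiv.Perm (Fin k)) H, ∃ m,
      Finset.univ.sup (e H ∘ σ) = Finset.Icc 1 m := by
    intro σ H
    obtain ⟨m, hm⟩ := H.1.2.1.2
    refine ⟨m, ?_⟩
    rw [← hm, ← hmap σ H, Finset.sup_def]
  let F : Equiv.Perm (Fin k) × {H : SimpleSystem n // H.1.card = k} → subsetSeqs k n :=
    fun p => ⟨incidenceSeq (e p.2 ∘ p.1), by
      obtain ⟨m, hm⟩ := hsup p.1 p.2
      refine incidenceSeq_mem hm ?_
      refine Eq.trans ?_ p.2.1.2.2.1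
      rw [sysWeight, ← hmap p.1 p.2, Multiset.map_map]
      rfl⟩
  have hF : Function.Injective F := by
    rintro ⟨σ, H⟩ ⟨τ, H'⟩ h
    obtain ⟨m, hm⟩ := hsup σ H
    obtain ⟨m', hm'⟩ := hsup τ H'
    have h : e H ∘ σ = e H' ∘ τ := eq_of_incidenceSeq_eq hm hm' (congrArg Subtype.val h)
    obtain rfl : H = H' := Subtype.ext (Subtype.ext (by rw [← hmap σ H, ← hmap τ H', h]))
    congr 1
    ext i
    exact congrArg Fin.val (hinj H (congrFun h i))
  have hle := Nat.card_le_card_of_injective F hF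
  rwa [Nat.card_prod, Nat.card_perm, Nat.card_fin] at hle

theorem hp_le (n : ℕ) : (hp n : ℝ) ≤ (n + 1) * ((1 / Real.log 2) ^ n * bell n) := by
  have hρ : 0 < Real.log 2 := Real.log_pos (by norm_num)
  rw [hp, card_eq_sum_card_fiber (fun H : SimpleSystem n => H.1.card) n
    fun H => (card_le_sysWeight H.2.1.1).trans H.2.2.1.le]
  push_cast
  calc _ ≤ ∑ _k ∈ Finset.range (n + 1), (1 / Real.log 2) ^ n * (bell n : ℝ) := by
        refine Finset.sum_le_sum fun k _ => ?_
        have h1 : (k.factorial : ℝ) * Nat.card {H : SimpleSystem n // H.1.card = k} ≤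
            seqCount k n := by
          exact_mod_cast factorial_mul_card_simpleSystem_le n k
        have h2 : (k : ℝ) ^ n ≤ k.factorial * bell n := by
          exact_mod_cast pow_le_factorial_mul_bell n k
        have hk : (0 : ℝ) < k.factorial := by positivity
        refine le_of_mul_le_mul_left ?_ hk
        calc _ ≤ (seqCount k n : ℝ) := h1
          _ ≤ (k / Real.log 2) ^ n := seqCount_le k n
          _ = (1 / Real.log 2) ^ n * (k : ℝ) ^ n := by rw [← mul_pow]; ring
          _ ≤ (1 / Real.log 2) ^ n * (k.factorial * bell n) := by gcongr
          _ = _ := by ring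
    _ = _ := by simp

theorem exists_one_le_sum_pow_div_factorial {r : ℝ} (hr : Real.log 2 < r) :
    ∃ K, 1 ≤ ∑ c ∈ Finset.range K, r ^ (c + 1) / (c + 1).factorial := by
  have h2 : 2 < Real.exp r := (Real.log_lt_iff_lt_exp (by norm_num)).1 hr
  have h := (NormedSpace.expSeries_div_hasSum_exp r).tendsto_sum_nat
  rw [← Real.exp_eq_exp_ℝ] at h
  have h' := (tendsto_add_atTop_iff_nat 1).2 h
  obtain ⟨K, hK⟩ := (h'.eventually (lt_mem_nhds h2)).exists
  refine ⟨K, ?_⟩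
  rw [Finset.sum_range_succ'] at hK
  simp only [pow_zero, Nat.factorial_zero, Nat.cast_one, div_one] at hK
  linarith

theorem exists_mul_exp_eq (n : ℕ) : ∃ x : ℝ, 0 ≤ x ∧ x * Real.exp x = n := by
  have hc : ContinuousOn (fun x : ℝ => x * Real.exp x) (Set.Icc 0 n) := by fun_prop
  have hn : (0 : ℝ) ≤ n := Nat.cast_nonneg n
  obtain ⟨x, hx, h⟩ := intermediate_value_Icc hn hc (show (n : ℝ) ∈ _ from
    ⟨by simp, le_mul_of_one_le_right hn (Real.one_le_exp hn)⟩)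
  exact ⟨x, hx.1, h⟩

theorem tendsto_log_succ_div : Tendsto (fun n : ℕ => Real.log (n + 1) / n) atTop (nhds 0) := by
  have h := Real.tendsto_pow_log_div_mul_add_atTop 1 (-1) 1 one_ne_zero
  have h' := h.comp (tendsto_atTop_add_const_right atTop (1 : ℝ) tendsto_natCast_atTop_atTop)
  refine h'.congr fun n => ?_
  simp

theorem hp_pos {n : ℕ} (hn : n ≠ 0) : 0 < hp n := by
  have h := (pow_le_seqCount 1 (n - 1)).trans (seqCount_le_hp (Nat.one_le_iff_ne_zero.2 hn))
  rw [one_pow] at h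
  omega

theorem log_hp_div_bell_ge {K : ℕ} {r : ℝ} (hr : 0 < r) (hr1 : r < 1)
    (hK : 1 ≤ ∑ c ∈ Finset.range K, r ^ (c + 1) / (c + 1).factorial) {n : ℕ} {x : ℝ}
    (hn : x * Real.exp x = n) (hx : 1 ≤ x) (hxK : K + 1 ≤ Real.exp x) :
    K * Real.log r * (1 / n) - Real.exp (-x) +
        (1 - x⁻¹ - 1 / n) * (Real.log (1 - K * Real.exp (-x)) - Real.log r) -
        Real.log (n + 1) / n - x⁻¹ ≤ Real.log (hp n / bell n) / n := by
  have hx0 : 0 < x := by linarith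
  have hn0 : (0 : ℝ) < n := by rw [← hn]; positivity
  have hn' : n ≠ 0 := by rintro rfl; simp at hn0
  have hb : (0 : ℝ) < bell n := by exact_mod_cast bell_pos n
  have hh : (0 : ℝ) < hp n := by exact_mod_cast hp_pos hn'
  set k := ⌈Real.exp x⌉₊ with hk
  have hk1 : Real.exp x ≤ k := Nat.le_ceil _
  have hk2 : (k : ℝ) ≤ Real.exp x + 1 := (Nat.ceil_lt_add_one (Real.exp_pos x).le).le
  have hkn : k ≤ n := by
    rw [hk, Nat.ceil_le, ← hn]
    exact le_mul_of_one_le_left (Real.exp_pos x).le hx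
  have hKk : K ≤ k := by
    have : (K : ℝ) ≤ k := by linarith
    exact_mod_cast this
  set y := Real.log (1 - K * Real.exp (-x)) with hy
  have hlogr : Real.log r < 0 := Real.log_neg hr hr1
  have hexpK : Real.exp x - K = Real.exp x * (1 - K * Real.exp (-x)) := by
    rw [mul_sub, mul_left_comm, ← Real.exp_add]
    simp
  have hpos : 0 < 1 - K * Real.exp (-x) := by
    refine pos_of_mul_pos_right (a := Real.exp x) ?_ (Real.exp_pos x).le
    rw [← hexpK]
    linarith
  have hxy : x + y = Real.log (Real.exp x - K) := by
    rw [hexpK, Real.log_mul (Real.exp_ne_zero x) hpos.ne', Real.log_exp]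
  have hxy0 : 0 ≤ x + y := by
    rw [hxy]
    exact Real.log_nonneg (by linarith)
  have hlow : K * Real.log r + (n - Real.exp x - 1) * (x + y - Real.log r) ≤
      Real.log (hp n) := by
    have h1 : r ^ K * (((k - K : ℕ) : ℝ) / r) ^ (n - k) ≤ hp n :=
      (le_seqCount hKk hr hr1.le hK (n - k)).trans (by exact_mod_cast seqCount_le_hp hkn)
    have hkK : Real.exp x - K ≤ ((k - K : ℕ) : ℝ) := by
      rw [Nat.cast_sub hKk]
      linarith
    have hkK0 : 0 < ((k - K : ℕ) : ℝ) := by linarith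
    have h2 := Real.log_le_log (by positivity) h1
    rw [Real.log_mul (by positivity) (by positivity), Real.log_pow, Real.log_pow,
      Real.log_div (by positivity) (by positivity), Nat.cast_sub hkn] at h2
    have h3 : x + y ≤ Real.log ((k - K : ℕ) : ℝ) := by
      rw [hxy]
      exact Real.log_le_log (by linarith) hkK
    have h4 : (n - Real.exp x - 1) * (x + y - Real.log r) ≤
        ((n : ℝ) - k) * (Real.log ((k - K : ℕ) : ℝ) - Real.log r) := by
      have : (0 : ℝ) ≤ n - k := by
        rw [sub_nonneg]
        exact_mod_cast hkn
      calc (n - Real.exp x - 1) * (x + y - Real.log r)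
          ≤ ((n : ℝ) - k) * (x + y - Real.log r) :=
            mul_le_mul_of_nonneg_right (by linarith) (by linarith)
        _ ≤ _ := mul_le_mul_of_nonneg_left (by linarith) this
    linarith
  have hup : Real.log (bell n) ≤ Real.log (n + 1) + (Real.exp x + n * x - n) := by
    have h := Real.log_le_log hb (bell_le hn' hx0.le hn)
    rwa [Real.log_mul (by positivity) (Real.exp_ne_zero _), Real.log_exp] at h
  rw [Real.log_div hh.ne' hb.ne', le_div_iff₀ hn0]
  refine le_trans (le_of_eq ?_) (sub_le_sub hlow hup)
  have he : Real.exp (-x) * n = x := by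
    rw [← hn, mul_left_comm, ← Real.exp_add]
    simp
  have hxi : x⁻¹ * n = Real.exp x := by
    rw [← hn]
    field_simp
  have h1n : 1 / (n : ℝ) * n = 1 := by field_simp
  have hl : Real.log (n + 1) / n * n = Real.log (n + 1) := by field_simp
  have hxx : (Real.exp x) * x = n := by rw [mul_comm, hn]
  calc _ = K * Real.log r * (1 / (n : ℝ) * n) - Real.exp (-x) * n +
        (n - x⁻¹ * n - 1 / (n : ℝ) * n) * (y - Real.log r) -
        Real.log (n + 1) / n * n - x⁻¹ * n := by ring
    _ = _ := by
      rw [he, hxi, h1n, hl]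
      linear_combination hxx

theorem tendsto_log_hp_div_bell :
    Tendsto (fun n : ℕ => Real.log (hp n / bell n) / n) atTop
      (nhds (-Real.log (Real.log 2))) := by
  have hρ : 0 < Real.log 2 := Real.log_pos (by norm_num)
  have hρ1 : Real.log (Real.log 2) < 0 :=
    Real.log_neg hρ (by linarith [Real.log_two_lt_d9])
  have hinv : Tendsto (fun n : ℕ => 1 / (n : ℝ)) atTop (nhds 0) :=
    tendsto_one_div_atTop_nhds_zero_nat
  refine tendsto_order.2 ⟨fun a ha => ?_, fun a ha => ?_⟩
  · obtain ⟨s, hs1, hs2⟩ := exists_between (lt_min (lt_neg.1 ha) hρ1)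
    have hr : Real.log 2 < Real.exp s := (Real.log_lt_iff_lt_exp hρ).1 hs1
    have hr1 : Real.exp s < 1 :=
      Real.exp_lt_one_iff.2 (hs2.trans_le (min_le_right _ _))
    have hsa : a < -s := lt_neg.1 (hs2.trans_le (min_le_left _ _))
    obtain ⟨K, hK⟩ := exists_one_le_sum_pow_div_factorial hr
    choose x hx0 hx using exists_mul_exp_eq
    have hxtop : Tendsto x atTop atTop := by
      refine tendsto_atTop.2 fun C => ?_
      filter_upwards [tendsto_natCast_atTop_atTop.eventually_gt_atTop
        (|C| * Real.exp |C|)] with n hn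
      by_contra! h
      have h' : x n ≤ |C| := h.le.trans (le_abs_self C)
      have h0 := hx0 n
      refine hn.not_ge ?_
      rw [← hx n]
      gcongr
    have hexp : Tendsto (fun n => Real.exp (-x n)) atTop (nhds 0) :=
      Real.tendsto_exp_neg_atTop_nhds_zero.comp hxtop
    have hxi : Tendsto (fun n => (x n)⁻¹) atTop (nhds 0) := tendsto_inv_atTop_zero.comp hxtop
    have hlog : Tendsto (fun n => Real.log (1 - K * Real.exp (-x n))) atTop
        (nhds (Real.log (1 - K * 0))) :=
      ((hexp.const_mul (K : ℝ)).const_sub 1).log (by simp)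
    have hlim := ((((hinv.const_mul (K * Real.log (Real.exp s))).sub hexp).add
      (((hxi.const_sub 1).sub hinv).mul (hlog.sub_const (Real.log (Real.exp s))))).sub
        tendsto_log_succ_div).sub hxi
    have hval : K * Real.log (Real.exp s) * 0 - 0 +
        (1 - 0 - 0) * (Real.log (1 - K * 0) - Real.log (Real.exp s)) - 0 - 0 = -s := by
      simp
    rw [hval] at hlim
    filter_upwards [hlim.eventually (lt_mem_nhds hsa), hxtop.eventually_ge_atTop 1,
      (Real.tendsto_exp_atTop.comp hxtop).eventually_ge_atTop (K + 1 : ℝ)] with n h1 h2 h3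
    exact h1.trans_le (log_hp_div_bell_ge (Real.exp_pos s) hr1 hK (hx n) h2 h3)
  · have hlim := tendsto_log_succ_div.add_const (-Real.log (Real.log 2))
    rw [zero_add] at hlim
    filter_upwards [hlim.eventually (gt_mem_nhds ha), eventually_gt_atTop 0] with n h1 hn
    refine lt_of_le_of_lt ?_ h1
    have hn0 : (0 : ℝ) < n := by exact_mod_cast hn
    have hb : (0 : ℝ) < bell n := by exact_mod_cast bell_pos n
    have hh : (0 : ℝ) < hp n := by exact_mod_cast hp_pos hn.ne'
    have h2 : (hp n : ℝ) / bell n ≤ (n + 1) * (1 / Real.log 2) ^ n := by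
      rw [div_le_iff₀ hb, mul_assoc]
      exact hp_le n
    have h3 := Real.log_le_log (by positivity) h2
    rw [Real.log_mul (by positivity) (by positivity), Real.log_pow, one_div, Real.log_inv] at h3
    calc _ ≤ (Real.log (n + 1) + n * -Real.log (Real.log 2)) / n := by gcongr
      _ = _ := by field_simp

/-- As `n → ∞`, the number `hₙ'` of simple normalized set systems of weight `n`
satisfies `hₙ' = ((log 2)⁻¹ + o(1))ⁿ · bₙ`; equivalently,
`lim (hₙ'/bₙ)^{1/n} = 1/log 2`. -/
theorem hp_asymptotics :
    Tendsto (fun n : ℕ => ((hp n : ℝ) / (bell n : ℝ)) ^ ((1 : ℝ) / n))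
      atTop (nhds (1 / Real.log 2)) := by
  have hρ : 0 < Real.log 2 := Real.log_pos (by norm_num)
  have h := (Real.continuous_exp.tendsto _).comp tendsto_log_hp_div_bell
  rw [Real.exp_neg, Real.exp_log hρ, ← one_div] at h
  refine h.congr' ?_
  filter_upwards [eventually_gt_atTop 0] with n hn
  have hb : (0 : ℝ) < bell n := by exact_mod_cast bell_pos n
  have hh : (0 : ℝ) < hp n := by exact_mod_cast hp_pos hn.ne'
  rw [Function.comp_apply, Real.rpow_def_of_pos (by positivity), mul_one_div]
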